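/- Let 𝒳 be a complete separable metric space with its Borel σ-algebra, let 𝒴 be a finite set with the discrete metric, and let P be a Borel probability measure on 𝒳 × 𝒴. Let f : (0,∞) → ℝ be strictly convex with f(1) = 0, f(0) := lim_{t→0+} f(t) finite, and f*(y) finite for all y ∈ ℝ, and let δ > 0. Let ℒ : 𝒳 × 𝒴 → [0,∞] be lower semicontinuous. If inf_{Q : D_f(Q‖P) ≤ δ} E_Q[ℒ] = 0, then there exists a Borel probability measure Q̃ on 𝒳 × 𝒴 with D_f(Q̃‖P) ≤ δ and E_{Q̃}[ℒ] = 0; i.e. the infimum over the f-divergence neighborhood is attained. -/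

import Mathlib

open MeasureTheory Classical
open scoped ENNReal BigOperators

/-- The `f`-divergence `D_f(Q ‖ P) = E_P[f(dQ/dP)]` when `Q ≪ P` (and the integrand is
integrable), and `∞` otherwise, valued in the extended reals. -/
noncomputable def fDiv {Ω : Type*} [MeasurableSpace Ω] (f : ℝ → ℝ) (Q P : Measure Ω) : EReal :=
  if Q ≪ P ∧ Integrable (fun ω => f ((Q.rnDeriv P) ω).toReal) P
  then ((∫ ω, f ((Q.rnDeriv P) ω).toReal ∂P : ℝ) : EReal)
  else ⊤

open Filter Topology Set in
lemma aux_cont (f : ℝ → ℝ) (hf_cvx : StrictConvexOn ℝ (Set.Ioi (0 : ℝ)) f)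
    (hf0 : ContinuousWithinAt f (Set.Ioi (0 : ℝ)) 0) : ContinuousOn f (Set.Ici 0) := by
  intro x hx
  rcases eq_or_lt_of_le (show (0:ℝ) ≤ x from hx) with h | h
  · subst h
    exact continuousWithinAt_Ioi_iff_Ici.mp hf0
  · have := (hf_cvx.convexOn.continuousOn isOpen_Ioi).continuousAt (Ioi_mem_nhds h)
    exact this.continuousWithinAt

open Filter Topology Set in
lemma aux_cvx (f : ℝ → ℝ) (hf_cvx : StrictConvexOn ℝ (Set.Ioi (0 : ℝ)) f)
    (hf0 : ContinuousWithinAt f (Set.Ioi (0 : ℝ)) 0) : ConvexOn ℝ (Set.Ici 0) f := by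
  have hc := aux_cont f hf_cvx hf0
  have key : ∀ z : ℝ, 0 ≤ z → Tendsto (fun t => f (z + t)) (𝓝[>] 0) (𝓝 (f z)) := by
    intro z hz
    refine Tendsto.comp (hc z hz) ?_
    refine tendsto_nhdsWithin_iff.mpr ⟨?_, ?_⟩
    · have : Tendsto (fun t : ℝ => z + t) (𝓝 0) (𝓝 (z + 0)) := by
        exact (continuous_const.add continuous_id).tendsto 0
      rw [add_zero] at this
      exact this.mono_left nhdsWithin_le_nhds
    · filter_upwards [self_mem_nhdsWithin] with t ht
      have : (0:ℝ) < t := ht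
      exact add_nonneg hz this.le
  refine ⟨convex_Ici 0, ?_⟩
  intro x hx y hy a b ha hb hab
  have hx' : (0:ℝ) ≤ x := hx
  have hy' : (0:ℝ) ≤ y := hy
  simp only [smul_eq_mul]
  refine le_of_tendsto_of_tendsto (key (a * x + b * y) (by positivity))
    (((key x hx').const_mul a).add ((key y hy').const_mul b)) ?_
  filter_upwards [self_mem_nhdsWithin] with t ht
  have ht' : (0:ℝ) < t := ht
  have h := hf_cvx.convexOn.2 (show x + t ∈ Ioi (0:ℝ) from by simp; linarith)
    (show y + t ∈ Ioi (0:ℝ) from by simp; linarith) ha hb hab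
  simp only [smul_eq_mul] at h
  have e : a * (x + t) + b * (y + t) = a * x + b * y + t := by
    linear_combination t * hab
  rwa [e] at h

lemma aux_jensen {Ω : Type*} [MeasurableSpace Ω] (P Q : Measure Ω) [IsProbabilityMeasure P]
    [IsProbabilityMeasure Q] (f : ℝ → ℝ) (hc : ContinuousOn f (Set.Ici 0))
    (hcv : ConvexOn ℝ (Set.Ici 0) f) (hQP : Q ≪ P)
    (hi : Integrable (fun ω => f ((Q.rnDeriv P) ω).toReal) P)
    (A : Set Ω) (hA : P.real A ≠ 0) :
    P.real A * f (Q.real A / P.real A) ≤ ∫ ω in A, f ((Q.rnDeriv P) ω).toReal ∂P := by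
  have hA' : P A ≠ 0 := fun h => hA (by simp [Measure.real, h])
  have h := hcv.map_set_average_le hc isClosed_Ici (μ := P) (t := A)
    (f := fun ω => ((Q.rnDeriv P) ω).toReal) hA' (measure_ne_top _ _)
    (by simp) (Measure.integrable_toReal_rnDeriv.integrableOn) hi.integrableOn
  rw [setAverage_eq, setAverage_eq, Measure.setIntegral_toReal_rnDeriv hQP] at h
  simp only [smul_eq_mul, Function.comp_def] at h
  have hp : 0 < P.real A := lt_of_le_of_ne measureReal_nonneg (Ne.symm hA)
  calc P.real A * f (Q.real A / P.real A)
      = P.real A * f ((P.real A)⁻¹ * Q.real A) := by rw [div_eq_inv_mul]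
    _ ≤ P.real A * ((P.real A)⁻¹ * ∫ ω in A, f ((Q.rnDeriv P) ω).toReal ∂P) := by gcongr
    _ = _ := by field_simp

lemma aux_fdiv {Ω : Type*} [MeasurableSpace Ω] (P Q : Measure Ω) (f : ℝ → ℝ) (δ : ℝ)
    (h : fDiv f Q P ≤ (δ : EReal)) :
    Q ≪ P ∧ Integrable (fun ω => f ((Q.rnDeriv P) ω).toReal) P ∧
      ∫ ω, f ((Q.rnDeriv P) ω).toReal ∂P ≤ δ := by
  unfold fDiv at h
  split_ifs at h with h1
  · exact ⟨h1.1, h1.2, by exact_mod_cast h⟩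
  · simp at h

open Filter Topology Set in
lemma aux_eps {Ω : Type*} [MeasurableSpace Ω] (P : Measure Ω) [IsProbabilityMeasure P]
    (f : ℝ → ℝ) (hc : ContinuousOn f (Set.Ici 0)) (hf1 : f 1 = 0)
    (hcv : ConvexOn ℝ (Set.Ici 0) f) (δ : ℝ) (hδ : 0 < δ) (A : Set Ω) (hA : MeasurableSet A)
    (h : ∀ η : ℝ, 0 < η → ∃ Q : Measure Ω, IsProbabilityMeasure Q ∧ fDiv f Q P ≤ (δ : EReal) ∧
      Q.real Aᶜ ≤ η) :
    0 < P.real A ∧ P.real A * f (1 / P.real A) + (1 - P.real A) * f 0 ≤ δ := by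
  have hp : 0 < P.real A := by
    obtain ⟨Q, hQ, hd, hη⟩ := h (1/2) (by norm_num)
    obtain ⟨hac, -, -⟩ := aux_fdiv P Q f δ hd
    refine lt_of_le_of_ne measureReal_nonneg fun h0 => ?_
    have : P A = 0 := by
      have := h0.symm
      rwa [measureReal_eq_zero_iff] at this
    have h1 : Q A = 0 := hac this
    have h2 := probReal_compl_eq_one_sub (μ := Q) hA
    rw [h2] at hη
    simp [Measure.real, h1] at hη
    norm_num at hη
  refine ⟨hp, ?_⟩
  by_cases h1 : P.real A = 1
  · simp [h1, hf1, hδ.le]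
  have hpl : P.real A ≤ 1 := measureReal_le_one
  have hr : 0 < 1 - P.real A := by
    have := lt_of_le_of_ne hpl h1
    linarith
  choose Q hQ hd hη using fun n : ℕ => h (1 / ((n:ℝ) + 1)) (by positivity)
  have hlim : Tendsto (fun n => (Q n).real Aᶜ) atTop (𝓝 0) :=
    squeeze_zero (fun n => measureReal_nonneg) hη tendsto_one_div_add_atTop_nhds_zero_nat
  have hlim2 : Tendsto (fun n => (Q n).real A) atTop (𝓝 1) := by
    have : (fun n => (Q n).real A) = fun n => 1 - (Q n).real Aᶜ := by
      funext n
      have := hQ n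
      rw [probReal_compl_eq_one_sub hA]; ring
    rw [this]
    simpa using hlim.const_sub 1
  have hb : ∀ n, P.real A * f ((Q n).real A / P.real A) +
      (1 - P.real A) * f ((Q n).real Aᶜ / (1 - P.real A)) ≤ δ := by
    intro n
    have := hQ n
    obtain ⟨hac, hi, hle⟩ := aux_fdiv P (Q n) f δ (hd n)
    have e := probReal_compl_eq_one_sub (μ := P) hA
    have j1 := aux_jensen P (Q n) f hc hcv hac hi A hp.ne'
    have j2 := aux_jensen P (Q n) f hc hcv hac hi Aᶜ (by rw [e]; exact hr.ne')
    rw [e] at j2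
    have := integral_add_compl hA hi
    linarith
  refine le_of_tendsto' (x := atTop) (Tendsto.add (Tendsto.const_mul _ ?_) (Tendsto.const_mul _ ?_)) hb
  · refine Tendsto.comp (hc (1 / P.real A) (by simp)) ?_
    refine tendsto_nhdsWithin_iff.mpr ⟨hlim2.div_const _, ?_⟩
    exact Eventually.of_forall fun n => by
      simp only [mem_Ici]; positivity
  · refine Tendsto.comp (hc 0 (by simp)) ?_
    refine tendsto_nhdsWithin_iff.mpr ⟨by simpa using hlim.div_const (1 - P.real A), ?_⟩
    exact Eventually.of_forall fun n => by
      simp only [mem_Ici]; positivity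

lemma aux_cond {Ω : Type*} [MeasurableSpace Ω] (P : Measure Ω) [IsProbabilityMeasure P]
    (f : ℝ → ℝ) (A : Set Ω) (hA : MeasurableSet A) (hp : 0 < P.real A) (δ : ℝ)
    (h : P.real A * f (1 / P.real A) + (1 - P.real A) * f 0 ≤ δ) :
    fDiv f ((P A)⁻¹ • P.restrict A) P ≤ (δ : EReal) := by
  have e : (P A)⁻¹ • P.restrict A = P.withDensity (A.indicator (fun _ => (P A)⁻¹)) := by
    rw [withDensity_indicator hA, withDensity_const]
  have hr := Measure.rnDeriv_withDensity P
    (f := A.indicator (fun _ => (P A)⁻¹)) (measurable_const.indicator hA)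
  have hae : (fun ω => f ((((P A)⁻¹ • P.restrict A).rnDeriv P) ω).toReal) =ᵐ[P]
      fun ω => A.indicator (fun _ => f (1 / P.real A)) ω + Aᶜ.indicator (fun _ => f 0) ω := by
    rw [e]
    filter_upwards [hr] with ω hω
    rw [hω]
    by_cases hm : ω ∈ A
    · simp [hm, Measure.real]
    · simp [hm]
  have i1 : Integrable (A.indicator (fun _ => f (1 / P.real A))) P :=
    (integrable_const _).indicator hA
  have i2 : Integrable (Aᶜ.indicator (fun _ => f 0)) P :=
    (integrable_const _).indicator hA.compl
  unfold fDiv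
  rw [if_pos]
  · rw [integral_congr_ae hae, integral_add i1 i2, integral_indicator_const _ hA,
      integral_indicator_const _ hA.compl, probReal_compl_eq_one_sub hA]
    exact_mod_cast h
  · refine ⟨?_, (integrable_congr hae).mpr (i1.add i2)⟩
    rw [e]; exact withDensity_absolutelyContinuous _ _

open Filter Topology Set in
lemma aux_main {Ω : Type*} [MeasurableSpace Ω] (P : Measure Ω) [IsProbabilityMeasure P]
    (f : ℝ → ℝ) (hf_cvx : StrictConvexOn ℝ (Set.Ioi (0 : ℝ)) f) (hf1 : f 1 = 0)
    (hf0 : ContinuousWithinAt f (Set.Ioi (0 : ℝ)) 0)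
    (hfstar : ∀ y : ℝ, BddAbove ((fun x => y * x - f x) '' Set.Ioi (0 : ℝ)))
    (δ : ℝ) (hδ : 0 < δ)
    (L : Ω → ℝ≥0∞) (hL : Measurable L)
    (hinf : (⨅ Q : {Q : Measure Ω // IsProbabilityMeasure Q ∧
        fDiv f Q P ≤ (δ : EReal)}, ∫⁻ p, L p ∂(Q : Measure Ω)) = 0) :
    ∃ Q : Measure Ω, IsProbabilityMeasure Q ∧ fDiv f Q P ≤ (δ : EReal) ∧
      ∫⁻ p, L p ∂Q = 0 := by
  have hc := aux_cont f hf_cvx hf0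
  have hcv := aux_cvx f hf_cvx hf0
  set u : ℕ → ℝ≥0∞ := fun n => ((n:ℝ≥0∞) + 1)⁻¹ with hu
  have hu0 : ∀ n, u n ≠ 0 := fun n => by simp [hu]
  have hut : ∀ n, u n ≠ ⊤ := fun n => by simp [hu]
  have hulim : Tendsto u atTop (𝓝 0) := by
    have := (tendsto_add_atTop_iff_nat 1).mpr ENNReal.tendsto_inv_nat_nhds_zero
    simpa [hu] using this
  have huanti : Antitone u := fun m n hmn => by
    simp only [hu]; gcongr
  have hmeas : ∀ n, MeasurableSet {x | L x < u n} := fun n => measurableSet_lt hL measurable_const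
  have heps : ∀ n, 0 < P.real {x | L x < u n} ∧ P.real {x | L x < u n} *
      f (1 / P.real {x | L x < u n}) + (1 - P.real {x | L x < u n}) * f 0 ≤ δ := by
    intro n
    refine aux_eps P f hc hf1 hcv δ hδ _ (hmeas n) ?_
    intro η hη
    have hpos : 0 < u n * ENNReal.ofReal η :=
      ENNReal.mul_pos (hu0 n) (by simpa using hη)
    rw [← hinf, iInf_lt_iff] at hpos
    obtain ⟨⟨Q, hQ, hd⟩, hlt⟩ := hpos
    refine ⟨Q, hQ, hd, ?_⟩
    have hm := mul_meas_ge_le_lintegral (μ := Q) hL (u n)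
    have h2 : u n * Q {x | u n ≤ L x} ≤ u n * ENNReal.ofReal η := hm.trans hlt.le
    rw [ENNReal.mul_le_mul_iff_right (hu0 n) (hut n)] at h2
    have e : {x | L x < u n}ᶜ = {x | u n ≤ L x} := by ext; simp
    rw [e]
    exact ENNReal.toReal_le_of_le_ofReal hη.le h2
  set A : Set Ω := {x | L x = 0} with hAdef
  have hA : MeasurableSet A := hL (measurableSet_singleton 0)
  have hAi : A = ⋂ n, {x | L x < u n} := by
    ext x
    simp only [hAdef, mem_setOf_eq, mem_iInter]
    constructor
    · intro h n; rw [h]; exact pos_iff_ne_zero.mpr (hu0 n)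
    · intro h
      exact le_antisymm (ge_of_tendsto' hulim fun n => (h n).le) bot_le
  have hplim : Tendsto (fun n => P.real {x | L x < u n}) atTop (𝓝 (P.real A)) := by
    have := tendsto_measure_iInter_atTop (μ := P) (s := fun n => {x | L x < u n})
      (fun n => (hmeas n).nullMeasurableSet)
      (fun m n hmn x hx => lt_of_lt_of_le hx (huanti hmn)) ⟨0, measure_ne_top _ _⟩
    rw [← hAi] at this
    exact (ENNReal.tendsto_toReal (measure_ne_top _ _)).comp this
  have hp : 0 < P.real A := by
    refine lt_of_le_of_ne measureReal_nonneg fun h0 => ?_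
    rw [← h0] at hplim
    obtain ⟨C, hC⟩ := hfstar (δ - f 0 + 1)
    have hb : ∀ n, (δ - f 0 + 1) - P.real {x | L x < u n} * C +
        (1 - P.real {x | L x < u n}) * f 0 ≤ δ := by
      intro n
      obtain ⟨h1, h2⟩ := heps n
      set p := P.real {x | L x < u n}
      have h3 : (δ - f 0 + 1) * (1 / p) - f (1 / p) ≤ C :=
        hC ⟨1 / p, by simpa using h1, rfl⟩
      have h4 := mul_le_mul_of_nonneg_left h3 h1.le
      have h5 : p * ((δ - f 0 + 1) * (1 / p) - f (1 / p)) = (δ - f 0 + 1) - p * f (1 / p) := by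
        field_simp
      linarith
    have := le_of_tendsto' (((hplim.mul_const C).const_sub (δ - f 0 + 1)).add
      ((hplim.const_sub 1).mul_const (f 0))) hb
    linarith
  have hfin : P.real A * f (1 / P.real A) + (1 - P.real A) * f 0 ≤ δ := by
    refine le_of_tendsto' ((hplim.mul ?_).add ((hplim.const_sub 1).mul_const (f 0)))
      (fun n => (heps n).2)
    refine Tendsto.comp (hc (1 / P.real A) (by simp)) ?_
    refine tendsto_nhdsWithin_iff.mpr ⟨tendsto_const_nhds.div hplim hp.ne', ?_⟩
    exact Eventually.of_forall fun n => by
      simp only [mem_Ici]; positivity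
  refine ⟨(P A)⁻¹ • P.restrict A, ?_, aux_cond P f A hA hp δ hfin, ?_⟩
  · have : P A ≠ 0 := fun h => hp.ne' (by simp [Measure.real, h])
    exact ProbabilityTheory.cond_isProbabilityMeasure this
  · rw [lintegral_smul_measure, setLIntegral_congr_fun (g := fun _ => 0) hA (fun x hx => hx)]
    simp

/-- On a complete separable metric space `𝒳` (Borel) times a finite
discrete label space `𝒴`, for strictly convex `f` with `f(1)=0`, finite `f(0)` and
everywhere-finite Legendre transform, `δ > 0`, and lower semicontinuous `ℒ : 𝒳 × 𝒴 → [0,∞]`: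
if `inf_{Q : D_f(Q‖P) ≤ δ} E_Q[ℒ] = 0` then the infimum is attained, i.e. there exists a
Borel probability measure `Q̃` with `D_f(Q̃‖P) ≤ δ` and `E_{Q̃}[ℒ] = 0`. -/
theorem relaxed_infimum_attained
    {𝒳 : Type*} [MetricSpace 𝒳] [CompleteSpace 𝒳] [TopologicalSpace.SeparableSpace 𝒳]
    [MeasurableSpace 𝒳] [BorelSpace 𝒳]
    {𝒴 : Type*} [Fintype 𝒴] [TopologicalSpace 𝒴] [DiscreteTopology 𝒴]
    [MeasurableSpace 𝒴] [BorelSpace 𝒴]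
    (P : Measure (𝒳 × 𝒴)) [IsProbabilityMeasure P]
    (f : ℝ → ℝ) (hf_cvx : StrictConvexOn ℝ (Set.Ioi (0 : ℝ)) f) (hf1 : f 1 = 0)
    (hf0 : ContinuousWithinAt f (Set.Ioi (0 : ℝ)) 0)
    (hfstar : ∀ y : ℝ, BddAbove ((fun x => y * x - f x) '' Set.Ioi (0 : ℝ)))
    (δ : ℝ) (hδ : 0 < δ)
    (L : 𝒳 × 𝒴 → ℝ≥0∞) (hL : LowerSemicontinuous L)
    (hinf : (⨅ Q : {Q : Measure (𝒳 × 𝒴) // IsProbabilityMeasure Q ∧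
        fDiv f Q P ≤ (δ : EReal)}, ∫⁻ p, L p ∂(Q : Measure (𝒳 × 𝒴))) = 0) :
    ∃ Q : Measure (𝒳 × 𝒴), IsProbabilityMeasure Q ∧ fDiv f Q P ≤ (δ : EReal) ∧
      ∫⁻ p, L p ∂Q = 0 := by
  have : SecondCountableTopology 𝒳 := UniformSpace.secondCountable_of_separable 𝒳
  exact aux_main P f hf_cvx hf1 hf0 hfstar δ hδ L hL.measurable hinf
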